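/- Let α, β, γ ∈ P^(1) be points of the Hesse polytope such that α − β, α − γ, β − γ ∈ R(E7) and (α − β)·(α − γ) = 1. If δ ∈ S = {v ∈ R(E8) : v·ρ = 1} satisfies δ·(β − γ) = 0, then δ·β ≥ 0. -/

import Mathlib

noncomputable section

/-- Standard basis vector `e i` of `ℝ^8`. -/
def e (i : Fin 8) : Fin 8 → ℝ := fun k => if k = i then 1 else 0

/-- The vector `ρ = (1/2, …, 1/2)`. -/
def ρ : Fin 8 → ℝ := fun _ => 1 / 2

/-- Standard inner product on `ℝ^8`. -/
def dot (x y : Fin 8 → ℝ) : ℝ := ∑ i, x i * y i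

/-- The `E8` root lattice `Λ(E8) = ℤ^8 ∪ (ℤ^8 + ρ)`. -/
def LatticeE8 : Set (Fin 8 → ℝ) :=
  {v | (∀ i, ∃ n : ℤ, v i = n) ∨ (∀ i, ∃ n : ℤ, v i = n + 1 / 2)}

/-- The `E8` root system `R(E8) = {v ∈ Λ(E8) : v·v = 2}`. -/
def RE8 : Set (Fin 8 → ℝ) := {v ∈ LatticeE8 | dot v v = 2}

/-- The `E7` root system `R(E7) = {v ∈ R(E8) : v·ρ = 0}`. -/
def RE7 : Set (Fin 8 → ℝ) := {v ∈ RE8 | dot v ρ = 0}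
/-- The Hesse polytope `P^(1)`: the convex hull of the vectors `e_i + e_j` and `ρ - e_i - e_j`
for `0 ≤ i < j ≤ 7`. -/
def Hesse : Set (Fin 8 → ℝ) :=
  convexHull ℝ
    ({v | ∃ i j : Fin 8, i < j ∧ v = e i + e j} ∪
      {v | ∃ i j : Fin 8, i < j ∧ v = ρ - e i - e j})

lemma dot_comm (x y : Fin 8 → ℝ) : dot x y = dot y x := by
  simp only [dot, mul_comm]

lemma dot_add_right (x y z : Fin 8 → ℝ) : dot x (y + z) = dot x y + dot x z := by
  simp [dot, mul_add, Finset.sum_add_distrib]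

lemma dot_sub_right (x y z : Fin 8 → ℝ) : dot x (y - z) = dot x y - dot x z := by
  simp [dot, mul_sub, Finset.sum_sub_distrib]

lemma dot_smul_right (c : ℝ) (x y : Fin 8 → ℝ) : dot x (c • y) = c * dot x y := by
  simp only [dot, Pi.smul_apply, smul_eq_mul, Finset.mul_sum]
  exact Finset.sum_congr rfl fun i _ => by ring

lemma dot_add_left (x y z : Fin 8 → ℝ) : dot (x + y) z = dot x z + dot y z := by
  rw [dot_comm, dot_add_right, dot_comm z x, dot_comm z y]

lemma dot_sub_left (x y z : Fin 8 → ℝ) : dot (x - y) z = dot x z - dot y z := by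
  rw [dot_comm, dot_sub_right, dot_comm z x, dot_comm z y]

lemma dot_e (x : Fin 8 → ℝ) (i : Fin 8) : dot x (e i) = x i := by
  simp [dot, e]

lemma dot_self_nonneg (x : Fin 8 → ℝ) : 0 ≤ dot x x :=
  Finset.sum_nonneg fun i _ => mul_self_nonneg (x i)

lemma eq_zero_of_dot_self {x : Fin 8 → ℝ} (h : dot x x = 0) : x = 0 := by
  funext i
  exact mul_self_eq_zero.mp
    ((Finset.sum_eq_zero_iff_of_nonneg fun i _ => mul_self_nonneg (x i)).mp h i
      (Finset.mem_univ i))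

lemma dot_ρ_ρ : dot ρ ρ = 2 := by
  norm_num [dot, ρ]

/-- The vertices of the Hesse polytope. -/
def hesseVertices : Set (Fin 8 → ℝ) :=
  {v | ∃ i j : Fin 8, i < j ∧ v = e i + e j} ∪
    {v | ∃ i j : Fin 8, i < j ∧ v = ρ - e i - e j}

lemma dot_self_of_mem_hesseVertices {v : Fin 8 → ℝ} (hv : v ∈ hesseVertices) :
    dot v v = 2 := by
  rcases hv with ⟨i, j, hij, rfl⟩ | ⟨i, j, hij, rfl⟩
  · norm_num [dot_add_right, dot_e, e, hij.ne, hij.ne']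
  · simp only [dot_sub_right, dot_sub_left, dot_e, dot_ρ_ρ, dot_comm (e _) ρ]
    norm_num [e, ρ, hij.ne, hij.ne']

lemma dot_ρ_of_mem_hesseVertices {v : Fin 8 → ℝ} (hv : v ∈ hesseVertices) :
    dot v ρ = 1 := by
  rw [dot_comm]
  rcases hv with ⟨i, j, -, rfl⟩ | ⟨i, j, -, rfl⟩
  · norm_num [dot_add_right, dot_e, ρ]
  · simp only [dot_sub_right, dot_e, dot_ρ_ρ]
    norm_num [ρ]

lemma exists_int_add_of_mem_LatticeE8 {w : Fin 8 → ℝ} (hw : w ∈ LatticeE8) (i j : Fin 8) :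
    ∃ n : ℤ, w i + w j = n := by
  rcases hw with h | h
  · obtain ⟨a, ha⟩ := h i
    obtain ⟨b, hb⟩ := h j
    exact ⟨a + b, by push_cast; rw [ha, hb]⟩
  · obtain ⟨a, ha⟩ := h i
    obtain ⟨b, hb⟩ := h j
    exact ⟨a + b + 1, by push_cast; rw [ha, hb]; ring⟩

lemma exists_int_dot_of_mem_hesseVertices {w v : Fin 8 → ℝ} (hw : w ∈ LatticeE8) {m : ℤ}
    (hm : dot w ρ = m) (hv : v ∈ hesseVertices) : ∃ n : ℤ, dot w v = n := by
  rcases hv with ⟨i, j, -, rfl⟩ | ⟨i, j, -, rfl⟩ <;>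
    obtain ⟨n, hn⟩ := exists_int_add_of_mem_LatticeE8 hw i j
  · exact ⟨n, by rw [dot_add_right, dot_e, dot_e, hn]⟩
  · refine ⟨m - n, ?_⟩
    rw [dot_sub_right, dot_sub_right, dot_e, dot_e, hm]
    push_cast
    linarith

lemma abs_dot_le_one {r v : Fin 8 → ℝ} (hr : r ∈ RE7) (hv : v ∈ hesseVertices) :
    |dot r v| ≤ 1 := by
  obtain ⟨⟨hrL, hrr⟩, hrρ⟩ := hr
  have hvv := dot_self_of_mem_hesseVertices hv
  have hvρ := dot_ρ_of_mem_hesseVertices hv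
  obtain ⟨n, hn⟩ := exists_int_dot_of_mem_hesseVertices hrL (m := 0) (by simpa using hrρ) hv
  have hsub : dot (r - v) (r - v) = 4 - 2 * n := by
    rw [dot_sub_left, dot_sub_right, dot_sub_right, dot_comm v r, hrr, hvv, hn]; ring
  have hadd : dot (r + v) (r + v) = 4 + 2 * n := by
    rw [dot_add_left, dot_add_right, dot_add_right, dot_comm v r, hrr, hvv, hn]; ring
  have h1 : (n : ℝ) ≠ 2 := fun h => by
    have h0 := sub_eq_zero.mp (eq_zero_of_dot_self (hsub.trans (by rw [h]; norm_num)))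
    rw [h0, hvρ] at hrρ
    norm_num at hrρ
  have h2 : (n : ℝ) ≠ -2 := fun h => by
    have h0 := eq_zero_of_dot_self (hadd.trans (by rw [h]; norm_num))
    have h3 : dot (r + v) ρ = 0 := by rw [h0]; simp [dot]
    rw [dot_add_left, hrρ, hvρ] at h3
    norm_num at h3
  have h3 : (n : ℝ) ≤ 2 := by linarith [dot_self_nonneg (r - v)]
  have h4 : -2 ≤ (n : ℝ) := by linarith [dot_self_nonneg (r + v)]
  rw [hn]
  norm_cast at *
  rw [abs_le]
  omega

lemma dot_le_dot_add_one {r δ v : Fin 8 → ℝ} (hr : r ∈ RE7) (hδ : δ ∈ RE8)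
    (hδρ : dot δ ρ = 1) (horth : dot δ r = 0) (hv : v ∈ hesseVertices) :
    dot r v ≤ dot δ v + 1 := by
  have hvv := dot_self_of_mem_hesseVertices hv
  have hvρ := dot_ρ_of_mem_hesseVertices hv
  have hle := (abs_le.mp (abs_dot_le_one hr hv)).2
  obtain ⟨n, hn⟩ := exists_int_dot_of_mem_hesseVertices hδ.1 (m := 1) (by simpa using hδρ) hv
  -- The squared length of `δ + v - ρ` detects the vertex antipodal to `δ`.
  have hsq : dot (δ + v - ρ) (δ + v - ρ) = 2 + 2 * n := by
    simp only [dot_sub_left, dot_sub_right, dot_add_left, dot_add_right, dot_comm v δ,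
      dot_comm ρ δ, dot_comm ρ v, hδ.2, hvv, hδρ, hvρ, hn, dot_ρ_ρ]
    ring
  have hlb : (-1 : ℝ) ≤ n := by linarith [dot_self_nonneg (δ + v - ρ)]
  rw [hn]
  rcases eq_or_ne n (-1) with rfl | hne
  · have h0 := eq_zero_of_dot_self (hsq.trans (by norm_num))
    have h1 : dot r (δ + v - ρ) = 0 := by rw [h0]; simp [dot]
    rw [dot_sub_right, dot_add_right, dot_comm r δ, horth, hr.2] at h1
    push_cast
    linarith
  · have hn0 : 0 ≤ n := by
      have : -1 ≤ n := by exact_mod_cast hlb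
      omega
    have : (0 : ℝ) ≤ n := by exact_mod_cast hn0
    linarith

lemma dot_le_of_mem_Hesse {w x : Fin 8 → ℝ} {c : ℝ}
    (h : ∀ v ∈ hesseVertices, dot w v ≤ c) (hx : x ∈ Hesse) : dot w x ≤ c := by
  have hlin : IsLinearMap ℝ (dot w) :=
    ⟨fun y z => dot_add_right w y z, fun a y => dot_smul_right a w y⟩
  exact convexHull_min (s := hesseVertices) h (convex_halfSpace_le hlin c) hx

theorem statement13 (α β γ : Fin 8 → ℝ)
    (hα : α ∈ Hesse) (hβ : β ∈ Hesse) (hγ : γ ∈ Hesse)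
    (hαβ : α - β ∈ RE7) (hαγ : α - γ ∈ RE7) (hβγ : β - γ ∈ RE7)
    (htri : dot (α - β) (α - γ) = 1)
    (δ : Fin 8 → ℝ) (hδ : δ ∈ RE8 ∧ dot δ ρ = 1)
    (horth : dot δ (β - γ) = 0) :
    0 ≤ dot δ β := by
  have hnorm : dot (β - γ) β - dot (β - γ) γ = 2 := by
    rw [← dot_sub_right]; exact hβγ.1.2
  have hneg : dot (0 - (β - γ)) γ ≤ 1 := by
    refine dot_le_of_mem_Hesse (fun v hv => ?_) hγ
    have h := (abs_le.mp (abs_dot_le_one hβγ hv)).1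
    have h0 : dot 0 v = 0 := by simp [dot]
    rw [dot_sub_left, h0]
    linarith
  have h0 : dot 0 γ = 0 := by simp [dot]
  rw [dot_sub_left, h0] at hneg
  have hmain : dot ((β - γ) - δ) β ≤ 1 := by
    refine dot_le_of_mem_Hesse (fun v hv => ?_) hβ
    rw [dot_sub_left]
    linarith [dot_le_dot_add_one hβγ hδ.1 hδ.2 horth hv]
  rw [dot_sub_left (β - γ) δ] at hmain
  linarith
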